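/- Consider an infinite-horizon decision problem where at each stage $t \in \mathbb{N}$ the decision maker chooses an action from a Polish space $X_t$, and the payoff is given by a bounded Borel-measurable function $u : X \to \mathbb{R}$ with $X = \prod_{t \in \mathbb{N}} X_t$. Then for every Markov strategy $\sigma = \bigotimes_{t \in \mathbb{N}} \sigma_t$ there exists an eventually pure Markov strategy $\tau = \bigotimes_{t \in \mathbb{N}} \tau_t$ (i.e., $\tau_t$ is a Dirac measure for all but finitely many $t$) with $\mathbb{E}_\tau[u] = \mathbb{E}_\sigma[u]$. Consequently, the set of expected payoffs obtainable by Markov strategies equals the set of expected payoffs obtainable by eventually pure Markov strategies. -/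

import Mathlib

open MeasureTheory

/-- `μ` is the product of the measures `μs t`: the measure of every measurable
cylinder is the product of the measures of its sides. -/
def IsProductMeasure {X : ℕ → Type*} [∀ t, MeasurableSpace (X t)]
    (μ : Measure (Π t, X t)) (μs : ∀ t, Measure (X t)) : Prop :=
  ∀ (I : Finset ℕ) (s : ∀ t, Set (X t)), (∀ t, MeasurableSet (s t)) →
    μ ((I : Set ℕ).pi s) = ∏ t ∈ I, μs t (s t)

lemma aux_cross {X : ℕ → Type*} [∀ t, MeasurableSpace (X t)]
    (u : (Π t, X t) → ℝ) (hu : Measurable u) (v : ℝ) (x : Π t, X t) (t : ℕ) (a : X t)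
    (h1 : u x ≤ v) (h2 : v ≤ u (Function.update x t a)) :
    ∃ (τs : ∀ t, Measure (X t)) (τ : Measure (Π t, X t)),
        (∀ t, IsProbabilityMeasure (τs t)) ∧ IsProductMeasure τ τs ∧
        {t | ¬ ∃ x : X t, τs t = Measure.dirac x}.Finite ∧
        ∫ x, u x ∂τ = v := by
  classical
  obtain ⟨p, q, hp, hq, hpq, hv⟩ : ∃ p q : ℝ, 0 ≤ p ∧ 0 ≤ q ∧ p + q = 1 ∧
      p * u x + q * u (Function.update x t a) = v := by
    have : v ∈ segment ℝ (u x) (u (Function.update x t a)) := by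
      rw [segment_eq_Icc (h1.trans h2)]; exact ⟨h1, h2⟩
    obtain ⟨p, q, hp, hq, hpq, hv⟩ := this
    exact ⟨p, q, hp, hq, hpq, by simpa using hv⟩
  have hpq' : ENNReal.ofReal p + ENNReal.ofReal q = 1 := by
    rw [← ENNReal.ofReal_add hp hq, hpq, ENNReal.ofReal_one]
  set P := ENNReal.ofReal p with hP
  set Q := ENNReal.ofReal q with hQ
  refine ⟨Function.update (fun i => Measure.dirac (x i)) t
      (P • Measure.dirac (x t) + Q • Measure.dirac a),
    P • Measure.dirac x + Q • Measure.dirac (Function.update x t a), ?_, ?_, ?_, ?_⟩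
  · intro i
    by_cases hi : i = t
    · subst hi
      simp only [Function.update_self]
      exact ⟨by simpa using hpq'⟩
    · simp only [Function.update_of_ne hi]
      infer_instance
  · intro I s hs
    have hd : ∀ (J : Finset ℕ) (y : Π t, X t), Measure.dirac y ((J : Set ℕ).pi s)
        = ∏ i ∈ J, Measure.dirac (y i) (s i) := by
      intro J y
      rw [Measure.dirac_apply' _ (MeasurableSet.pi J.countable_toSet (fun i _ => hs i))]
      simp only [Measure.dirac_apply' _ (hs _), Set.indicator_apply, Pi.one_apply]
      rw [Finset.prod_ite_zero]
      simp [Set.mem_pi]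
    simp only [Measure.add_apply, Measure.smul_apply, hd, smul_eq_mul]
    by_cases ht : t ∈ I
    · rw [← Finset.mul_prod_erase I _ ht, ← Finset.mul_prod_erase I _ ht,
        ← Finset.mul_prod_erase I _ ht]
      have e1 : ∏ i ∈ I.erase t, Measure.dirac (Function.update x t a i) (s i)
          = ∏ i ∈ I.erase t, Measure.dirac (x i) (s i) :=
        Finset.prod_congr rfl fun i hi => by
          rw [Function.update_of_ne (Finset.ne_of_mem_erase hi)]
      have e2 : ∏ i ∈ I.erase t, (Function.update (fun i => Measure.dirac (x i)) t
          (P • Measure.dirac (x t) + Q • Measure.dirac a) i) (s i)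
          = ∏ i ∈ I.erase t, Measure.dirac (x i) (s i) :=
        Finset.prod_congr rfl fun i hi => by
          rw [Function.update_of_ne (Finset.ne_of_mem_erase hi)]
      rw [e1, e2]
      simp only [Function.update_self, Measure.add_apply, Measure.smul_apply, smul_eq_mul]
      ring
    · have e1 : ∏ i ∈ I, Measure.dirac (Function.update x t a i) (s i)
          = ∏ i ∈ I, Measure.dirac (x i) (s i) :=
        Finset.prod_congr rfl fun i hi => by
          rw [Function.update_of_ne (ne_of_mem_of_not_mem hi ht)]
      have e2 : ∏ i ∈ I, (Function.update (fun i => Measure.dirac (x i)) t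
          (P • Measure.dirac (x t) + Q • Measure.dirac a) i) (s i)
          = ∏ i ∈ I, Measure.dirac (x i) (s i) :=
        Finset.prod_congr rfl fun i hi => by
          rw [Function.update_of_ne (ne_of_mem_of_not_mem hi ht)]
      rw [e1, e2, ← add_mul, hpq', one_mul]
  · refine (Set.finite_singleton t).subset fun i hi => ?_
    by_contra hne
    exact hi ⟨x i, Function.update_of_ne hne _ _⟩
  · have hi : ∀ y : Π t, X t, Integrable u (Measure.dirac y) := fun y =>
      integrable_dirac' hu.stronglyMeasurable (by simp)
    rw [integral_add_measure ((hi _).smul_measure (by simp [hP]))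
      ((hi _).smul_measure (by simp [hQ])), integral_smul_measure, integral_smul_measure,
      integral_dirac' _ _ hu.stronglyMeasurable, integral_dirac' _ _ hu.stronglyMeasurable]
    simp [hP, hQ, hp, hq, hv]

lemma aux_exists {X : ℕ → Type*} [∀ t, MeasurableSpace (X t)]
    (u : (Π t, X t) → ℝ) (hu : Measurable u) (C : ℝ) (hbd : ∀ x, |u x| ≤ C)
    (σs : ∀ t, Measure (X t)) (σ : Measure (Π t, X t))
    (hσs : ∀ t, IsProbabilityMeasure (σs t)) (hσ : IsProductMeasure σ σs) :
    ∃ (x : Π t, X t) (t : ℕ) (a : X t),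
      u x ≤ ∫ x, u x ∂σ ∧ ∫ x, u x ∂σ ≤ u (Function.update x t a) := by
  classical
  by_contra! hcon
  set v := ∫ x, u x ∂σ with hv
  have hσp : IsProbabilityMeasure σ := ⟨by simpa using hσ ∅ (fun _ => Set.univ) (by simp)⟩
  have hne : ∀ x, u x ≠ v := fun x hx => by
    have := hcon x 0 (x 0) hx.le
    rw [Function.update_eq_self] at this
    exact this.ne hx
  have hσeq : σ = Measure.infinitePi σs :=
    Measure.eq_infinitePi _ fun I s hs => hσ I s hs
  have hup : ∀ x t a, v < u x → v < u (Function.update x t a) := by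
    intro x t a hx
    by_contra! h
    have := hcon _ t (x t) h
    simp at this
    exact absurd this hx.not_gt
  have hup' : ∀ x t a, v < u (Function.update x t a) ↔ v < u x := by
    intro x t a
    refine ⟨fun h => ?_, hup x t a⟩
    simpa using hup _ t (x t) h
  obtain ⟨z⟩ : Nonempty (Π t, X t) := by
    by_contra h
    rw [not_nonempty_iff] at h
    have := hσp.measure_univ
    simp [Set.univ_eq_empty_iff.2 h] at this
  have hfin : ∀ n x, v < u (fun i => if i < n then z i else x i) ↔ v < u x := by
    intro n x
    induction n with
    | zero => simp
    | succ n ih =>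
      rw [← ih, ← hup' (fun i => if i < n then z i else x i) n (z n)]
      have : (fun i => if i < n + 1 then z i else x i)
          = Function.update (fun i => if i < n then z i else x i) n (z n) := by
        funext i
        by_cases hi : i = n
        · subst hi; simp
        · rw [Function.update_of_ne hi]
          have : i < n + 1 ↔ i < n := by omega
          simp [this]
      rw [this]
  let m : ∀ t : ℕ, MeasurableSpace (Π t, X t) := fun t => MeasurableSpace.comap (fun x => x t) inferInstance
  have hle : ∀ t, m t ≤ MeasurableSpace.pi := fun t => (measurable_pi_apply t).comap_le
  have hind : ProbabilityTheory.iIndep m σ := by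
    rw [hσeq]
    exact ProbabilityTheory.iIndepFun_infinitePi (P := σs) (X := fun i (x : X i) => x) (fun i => measurable_id)
  have hA : MeasurableSet[Filter.limsup m Filter.atTop] {x | v < u x} := by
    rw [Filter.limsup_eq_iInf_iSup_of_nat, MeasurableSpace.measurableSet_iInf]
    intro n
    have hm : @Measurable _ _ (⨆ i ≥ n, m i) MeasurableSpace.pi
        (fun (x : Π t, X t) (i : ℕ) => if i < n then z i else x i) := by
      refine @measurable_pi_lambda _ _ _ (_) _ _ fun i => ?_
      by_cases hi : i < n
      · simp only [hi, if_true]; exact @measurable_const _ _ _ (_) _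
      · simp only [hi, if_false]
        refine Measurable.mono (comap_measurable (fun x : Π t, X t => x i)) ?_ le_rfl
        exact le_iSup₂_of_le i (not_lt.1 hi) le_rfl
    have := hm (measurableSet_lt measurable_const hu : MeasurableSet {x | v < u x})
    convert this using 1
    ext x
    exact (hfin n x).symm
  have h01 := ProbabilityTheory.measure_zero_or_one_of_measurableSet_limsup_atTop hle hind hA
  have hint : Integrable u σ := Integrable.of_bound hu.aestronglyMeasurable C (ae_of_all _ hbd)
  have key : u =ᵐ[σ] fun _ => v := by
    rcases h01 with h | h
    · have hle' : u ≤ᵐ[σ] fun _ => v := by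
        have : ∀ᵐ x ∂σ, ¬ v < u x := by rw [ae_iff]; simpa using h
        filter_upwards [this] with x hx using not_lt.1 hx
      exact (integral_eq_iff_of_ae_le hint (integrable_const _) hle').1 (by simp [hv])
    · have hle' : (fun _ => v) ≤ᵐ[σ] u := by
        have : ∀ᵐ x ∂σ, v < u x := (prob_compl_eq_zero_iff
          (measurableSet_lt measurable_const hu)).2 h
        filter_upwards [this] with x hx using hx.le
      exact ((integral_eq_iff_of_ae_le (integrable_const _) hint hle').1 (by simp [hv])).symm
  obtain ⟨x, hx⟩ := key.exists
  exact hne x hx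

/-- In an infinite-horizon decision problem with bounded Borel-measurable payoff `u`,
every Markov strategy (a product probability measure) admits an eventually pure
Markov strategy with the same expected payoff; consequently the set of expected
payoffs of Markov strategies coincides with that of eventually pure Markov
strategies. -/
theorem markov_eventually_pure
    (X : ℕ → Type*) [∀ t, TopologicalSpace (X t)] [∀ t, PolishSpace (X t)]
    [∀ t, MeasurableSpace (X t)] [∀ t, BorelSpace (X t)]
    (u : (Π t, X t) → ℝ) (hu : Measurable u) (C : ℝ) (hbd : ∀ x, |u x| ≤ C) :
    (∀ (σs : ∀ t, Measure (X t)) (σ : Measure (Π t, X t)),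
      (∀ t, IsProbabilityMeasure (σs t)) → IsProductMeasure σ σs →
      ∃ (τs : ∀ t, Measure (X t)) (τ : Measure (Π t, X t)),
        (∀ t, IsProbabilityMeasure (τs t)) ∧ IsProductMeasure τ τs ∧
        {t | ¬ ∃ x : X t, τs t = Measure.dirac x}.Finite ∧
        ∫ x, u x ∂τ = ∫ x, u x ∂σ) ∧
    {r : ℝ | ∃ (σs : ∀ t, Measure (X t)) (σ : Measure (Π t, X t)),
        (∀ t, IsProbabilityMeasure (σs t)) ∧ IsProductMeasure σ σs ∧
        r = ∫ x, u x ∂σ} =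
      {r : ℝ | ∃ (τs : ∀ t, Measure (X t)) (τ : Measure (Π t, X t)),
        (∀ t, IsProbabilityMeasure (τs t)) ∧ IsProductMeasure τ τs ∧
        {t | ¬ ∃ x : X t, τs t = Measure.dirac x}.Finite ∧
        r = ∫ x, u x ∂τ} := by
  have main : ∀ (σs : ∀ t, Measure (X t)) (σ : Measure (Π t, X t)),
      (∀ t, IsProbabilityMeasure (σs t)) → IsProductMeasure σ σs →
      ∃ (τs : ∀ t, Measure (X t)) (τ : Measure (Π t, X t)),
        (∀ t, IsProbabilityMeasure (τs t)) ∧ IsProductMeasure τ τs ∧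
        {t | ¬ ∃ x : X t, τs t = Measure.dirac x}.Finite ∧
        ∫ x, u x ∂τ = ∫ x, u x ∂σ := by
    intro σs σ h1 h2
    obtain ⟨x, t, a, hx, hy⟩ := aux_exists u hu C hbd σs σ h1 h2
    exact aux_cross u hu _ x t a hx hy
  refine ⟨main, Set.ext fun r => ⟨?_, ?_⟩⟩
  · rintro ⟨σs, σ, h1, h2, rfl⟩
    obtain ⟨τs, τ, h3, h4, h5, h6⟩ := main σs σ h1 h2
    exact ⟨τs, τ, h3, h4, h5, h6.symm⟩
  · rintro ⟨τs, τ, h3, h4, -, h6⟩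
    exact ⟨τs, τ, h3, h4, h6⟩
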